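/- Let B be the open unit ball in ℂ^n and let φ: B → ℝ be a smooth function whose complex Hessian g_{ij̄} = ∂_i∂_j̄φ is a positive definite Hermitian matrix at every point, and suppose the associated Kähler metric has constant holomorphic sectional curvature κ = −2, i.e. R_{ij̄kl̄} = −(g_{ij̄}g_{kl̄} + g_{il̄}g_{kj̄}) everywhere. Then for every point p ∈ B there exist an open neighborhood U ⊆ B of p and an injective holomorphic map f: U → ℂ^n with |f(z)| < 1 for all z ∈ U, such that g_{ij̄}(z) = −∂_i∂_j̄ [log(1 − |f(z)|²)] for all z ∈ U and all 1 ≤ i,j ≤ n. -/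

import Mathlib

noncomputable section
open Complex Matrix
open scoped ComplexOrder

/-- The Wirtinger derivative `∂ₖ f = (1/2)(∂f/∂xᵏ − i ∂f/∂yᵏ)` of a complex-valued
function on `ℂⁿ` (with its Euclidean structure), where `zᵏ = xᵏ + i yᵏ`. -/
def wd {n : ℕ} (k : Fin n) (f : EuclideanSpace ℂ (Fin n) → ℂ)
    (z : EuclideanSpace ℂ (Fin n)) : ℂ :=
  (1/2 : ℂ) * (fderiv ℝ f z (EuclideanSpace.single k 1)
    - Complex.I * fderiv ℝ f z (EuclideanSpace.single k Complex.I))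

/-- The conjugate Wirtinger derivative `∂ₖ̄ f = (1/2)(∂f/∂xᵏ + i ∂f/∂yᵏ)`. -/
def wdb {n : ℕ} (k : Fin n) (f : EuclideanSpace ℂ (Fin n) → ℂ)
    (z : EuclideanSpace ℂ (Fin n)) : ℂ :=
  (1/2 : ℂ) * (fderiv ℝ f z (EuclideanSpace.single k 1)
    + Complex.I * fderiv ℝ f z (EuclideanSpace.single k Complex.I))

/-- The inverse transpose matrix `(g^{ij̄})` of a matrix-valued function `(g_{ij̄})`. -/
def ginv {n : ℕ} (g : Fin n → Fin n → EuclideanSpace ℂ (Fin n) → ℂ)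
    (z : EuclideanSpace ℂ (Fin n)) : Matrix (Fin n) (Fin n) ℂ :=
  ((Matrix.of fun i j => g i j z)⁻¹)ᵀ

/-- The Riemann curvature tensor
`R_{ij̄kl̄} = −∂_k∂_l̄ g_{ij̄} + g^{pq̄}(∂_l̄ g_{pj̄})(∂_k g_{iq̄})`. -/
def Riem {n : ℕ} (g : Fin n → Fin n → EuclideanSpace ℂ (Fin n) → ℂ)
    (i j k l : Fin n) (z : EuclideanSpace ℂ (Fin n)) : ℂ :=
  - wd k (wdb l (g i j)) z
    + ∑ p, ∑ q, ginv g z p q * wdb l (g p j) z * wd k (g i q) z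

/-- The complex Hessian `g_{ij̄} = ∂_i ∂_j̄ φ` of a real-valued function `φ`. -/
def gmat {n : ℕ} (φ : EuclideanSpace ℂ (Fin n) → ℝ) (i j : Fin n)
    (z : EuclideanSpace ℂ (Fin n)) : ℂ :=
  wd i (wdb j (fun w => (φ w : ℂ))) z

section ODE
set_option linter.unusedSectionVars false
open scoped unitInterval Topology
open Set Metric

variable {E : Type*} [NormedAddCommGroup E] [NormedSpace ℂ E]
variable {F : Type*} [NormedAddCommGroup F] [NormedSpace ℂ F]

/-- pointwise evaluation of a path of linear maps on a vector -/
def pathEval : C(I, E →L[ℂ] F) →L[ℂ] E →L[ℂ] C(I, F) :=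
  LinearMap.mkContinuous₂
    (LinearMap.mk₂ ℂ (fun (ψ : C(I, E →L[ℂ] F)) (h : E) => (⟨fun s => ψ s h, by fun_prop⟩ : C(I, F)))
      (by intros; ext; simp) (by intros; ext; simp) (by intros; ext; simp) (by intros; ext; simp))
    1 (by
      intro ψ h
      rw [ContinuousMap.norm_le _ (by positivity)]
      intro s
      simp only [LinearMap.mk₂_apply, ContinuousMap.coe_mk, one_mul]
      exact (ContinuousLinearMap.le_opNorm _ _).trans
        (mul_le_mul_of_nonneg_right (ContinuousMap.norm_coe_le_norm ψ s) (norm_nonneg _)))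

@[simp] lemma pathEval_apply (ψ : C(I, E →L[ℂ] F)) (h : E) (s : I) :
    pathEval ψ h s = ψ s h := rfl

lemma intInt (γ : C(I, F)) (a b : ℝ) :
    IntervalIntegrable (fun s => IccExtend zero_le_one γ s) MeasureTheory.volume a b :=
  (γ.continuous.Icc_extend' (h := zero_le_one)).intervalIntegrable _ _

/-- The Volterra operator -/
def volterra [CompleteSpace F] : C(I, F) →L[ℂ] C(I, F) :=
  LinearMap.mkContinuous
    { toFun := fun γ => ⟨fun t => ∫ s in (0:ℝ)..t, IccExtend zero_le_one γ s, by
        have h := intervalIntegral.continuous_primitive (intInt γ) 0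
        exact h.comp continuous_subtype_val⟩
      map_add' := by
        intro γ η
        ext t
        simp only [ContinuousMap.coe_mk, ContinuousMap.add_apply]
        rw [← intervalIntegral.integral_add (intInt γ _ _) (intInt η _ _)]
        rfl
      map_smul' := by
        intro c γ
        ext t
        simp only [ContinuousMap.coe_mk, RingHom.id_apply, ContinuousMap.smul_apply]
        rw [← intervalIntegral.integral_smul]
        rfl }
    1 (by
      intro γ
      rw [ContinuousMap.norm_le _ (by positivity)]
      intro t
      simp only [LinearMap.coe_mk, AddHom.coe_mk, ContinuousMap.coe_mk, one_mul]
      have := intervalIntegral.norm_integral_le_of_norm_le_const (a := 0) (b := (t:ℝ))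
        (f := IccExtend zero_le_one γ) (C := ‖γ‖)
        (fun x _ => ContinuousMap.norm_coe_le_norm γ _)
      refine this.trans ?_
      have h0 := t.2.1
      have h1 := t.2.2
      rw [sub_zero, abs_of_nonneg h0]
      exact mul_le_of_le_one_right (norm_nonneg _) h1)

lemma volterra_apply [CompleteSpace F] (γ : C(I, F)) (t : I) :
    volterra γ t = ∫ s in (0:ℝ)..t, IccExtend zero_le_one γ s := rfl

open Classical in
/-- path of values of `M` along the ray from `p` to `z` -/
def rayPath (M : E → F) (p z : E) : C(I, F) :=
  if h : Continuous (fun s : I => M (p + ((s : ℝ) : ℂ) • (z - p))) then ⟨_, h⟩ else 0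

lemma ray_mem {p z : E} {r : ℝ} (hz : z ∈ ball p r) (s : I) :
    p + ((s : ℝ) : ℂ) • (z - p) ∈ ball p r := by
  rw [mem_ball, dist_eq_norm] at *
  rw [add_sub_cancel_left, norm_smul]
  refine lt_of_le_of_lt ?_ hz
  have h0 := s.2.1
  have h1 := s.2.2
  apply mul_le_of_le_one_left (norm_nonneg _)
  simpa [abs_of_nonneg h0] using h1

lemma rayPath_apply {M : E → F} {p z : E} {r : ℝ} (hM : ContinuousOn M (ball p r))
    (hz : z ∈ ball p r) (s : I) : rayPath M p z s = M (p + ((s : ℝ) : ℂ) • (z - p)) := by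
  have h : Continuous (fun s : I => M (p + ((s : ℝ) : ℂ) • (z - p))) :=
    hM.comp_continuous (by fun_prop) (fun s => ray_mem hz s)
  rw [rayPath, dif_pos h]
  rfl

lemma rayPath_differentiableAt {M : E → F} {M' : E → E →L[ℂ] F} {p z : E} {r : ℝ}
    (hM' : ContinuousOn M' (ball p r)) (hM : ∀ z ∈ ball p r, HasFDerivAt M (M' z) z)
    (hz : z ∈ ball p r) : DifferentiableAt ℂ (rayPath M p) z := by
  let _ : NormedSpace ℝ E := NormedSpace.restrictScalars ℝ ℂ E
  have hMc : ContinuousOn M (ball p r) := fun x hx => (hM x hx).continuousAt.continuousWithinAt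
  let ψ : C(I, E →L[ℂ] F) := ⟨fun s => ((s : ℝ) : ℂ) • M' (p + ((s : ℝ) : ℂ) • (z - p)), by
    have : Continuous (fun s : I => M' (p + ((s : ℝ) : ℂ) • (z - p))) :=
      hM'.comp_continuous (by fun_prop) (fun s => ray_mem hz s)
    have h2 : Continuous (fun s : I => ((s : ℝ) : ℂ)) := by fun_prop
    exact h2.smul this⟩
  have key : HasFDerivAt (rayPath M p) (pathEval ψ) z := by
    rw [hasFDerivAt_iff_isLittleO, Asymptotics.isLittleO_iff]
    intro ε hε
    have hcomp : IsCompact (range (fun s : I => p + ((s : ℝ) : ℂ) • (z - p))) :=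
      isCompact_range (by fun_prop)
    have hu := hcomp.uniformContinuousAt_of_continuousAt M' (r := {x | dist x.1 x.2 < ε})
      (by
        rintro _ ⟨s, rfl⟩
        exact hM'.continuousAt (isOpen_ball.mem_nhds (ray_mem hz s)))
      (dist_mem_uniformity hε)
    obtain ⟨δ, hδ, hδ'⟩ := Metric.mem_uniformity_dist.1 hu
    have hz' := hz
    rw [mem_ball] at hz'
    have hnear : ball z (min δ (r - dist z p)) ∈ 𝓝 z :=
      ball_mem_nhds _ (lt_min hδ (by linarith))
    filter_upwards [hnear] with y hy
    have hyδ : dist y z < δ := lt_of_lt_of_le hy (min_le_left _ _)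
    have hyr : y ∈ ball p r := by
      have h1 : dist y z < r - dist z p := lt_of_lt_of_le hy (min_le_right _ _)
      rw [mem_ball]
      linarith [dist_triangle y z p]
    rw [ContinuousMap.norm_le _ (by positivity)]
    intro s
    simp only [ContinuousMap.sub_apply, rayPath_apply hMc hyr, rayPath_apply hMc hz,
      pathEval_apply]
    have hs0 := s.2.1
    have hs1 := s.2.2
    have hsn : ‖((s : ℝ) : ℂ)‖ ≤ 1 := by simpa [abs_of_nonneg hs0] using hs1
    set S : Set E := ball p r ∩ ball (p + ((s : ℝ) : ℂ) • (z - p)) δ with hS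
    have hconv : Convex ℝ S := (convex_ball _ _).inter (convex_ball _ _)
    have hxS : p + ((s : ℝ) : ℂ) • (z - p) ∈ S := ⟨ray_mem hz s, mem_ball_self hδ⟩
    have hyS : p + ((s : ℝ) : ℂ) • (y - p) ∈ S := by
      refine ⟨ray_mem hyr s, ?_⟩
      rw [mem_ball, dist_eq_norm]
      have : p + ((s : ℝ) : ℂ) • (y - p) - (p + ((s : ℝ) : ℂ) • (z - p))
        = ((s : ℝ) : ℂ) • (y - z) := by module
      rw [this, norm_smul]
      rw [dist_eq_norm] at hyδ
      exact lt_of_le_of_lt (mul_le_of_le_one_left (norm_nonneg _) hsn) hyδ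
    have := hconv.norm_image_sub_le_of_norm_hasFDerivWithin_le' (𝕜 := ℂ) (f := M) (f' := M')
      (φ := M' (p + ((s : ℝ) : ℂ) • (z - p))) (C := ε)
      (fun x hx => (hM x hx.1).hasFDerivWithinAt)
      (fun x hx => by
        have h2 := @hδ' (p + ((s : ℝ) : ℂ) • (z - p)) x (by rw [dist_comm]; exact hx.2) ⟨s, rfl⟩
        simp only [mem_ofPred_eq] at h2
        rw [← dist_eq_norm, dist_comm]
        exact h2.le) hxS hyS
    have e : p + ((s : ℝ) : ℂ) • (y - p) - (p + ((s : ℝ) : ℂ) • (z - p))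
        = ((s : ℝ) : ℂ) • (y - z) := by module
    rw [e, map_smul, norm_smul] at this
    have e2 : (ψ s) (y - z) = ((s : ℝ) : ℂ) • (M' (p + ((s : ℝ) : ℂ) • (z - p))) (y - z) := rfl
    rw [e2]
    refine this.trans ?_
    exact mul_le_mul_of_nonneg_left (mul_le_of_le_one_left (norm_nonneg _) hsn) hε.le
  exact key.differentiableAt

lemma neumann_family {X : Type*} [NormedAddCommGroup X] [NormedSpace ℂ X] [CompleteSpace X]
    {L : E → X →L[ℂ] X} {p : E} {r : ℝ} (hr : 0 < r)
    (hL : ∀ z ∈ ball p r, DifferentiableAt ℂ L z) (hLp : L p = 0) (x₀ : X) :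
    ∃ δ > 0, δ ≤ r ∧ ∃ Γ : E → X, Γ p = x₀ ∧ (∀ z ∈ ball p δ, DifferentiableAt ℂ Γ z) ∧
      ∀ z ∈ ball p δ, Γ z = x₀ + L z (Γ z) := by
  have hpr : p ∈ ball p r := mem_ball_self hr
  have hD : ∀ z ∈ ball p r, DifferentiableAt ℂ (fun z => 1 - L z) z :=
    fun z hz => (differentiableAt_const _).fun_sub (hL z hz)
  have hunit : ∀ᶠ z in 𝓝 p, IsUnit (1 - L z) := by
    have hc : ContinuousAt (fun z => 1 - L z) p := (hD p hpr).continuousAt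
    have : {x : X →L[ℂ] X | IsUnit x} ∈ 𝓝 (1 - L p) := by
      apply Units.isOpen.mem_nhds
      simp [hLp]
    exact hc.eventually_mem this
  obtain ⟨δ, hδ, hδu⟩ := Metric.eventually_nhds_iff_ball.1 hunit
  refine ⟨min δ r, lt_min hδ hr, min_le_right _ _, fun z => Ring.inverse (1 - L z) x₀, ?_, ?_, ?_⟩
  · simp [hLp]
  · intro z hz
    have hzr : z ∈ ball p r := ball_subset_ball (min_le_right _ _) hz
    have hzδ : z ∈ ball p δ := ball_subset_ball (min_le_left _ _) hz
    have h1 : DifferentiableAt ℂ (fun z => Ring.inverse (1 - L z)) z :=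
      DifferentiableAt.comp (g := Ring.inverse) z (differentiableAt_inverse (hδu z hzδ)) (hD z hzr)
    exact h1.clm_apply (differentiableAt_const _)
  · intro z hz
    have hzδ : z ∈ ball p δ := ball_subset_ball (min_le_left _ _) hz
    have h := Ring.mul_inverse_cancel _ (hδu z hzδ)
    have h2 := congrArg (fun T : X →L[ℂ] X => T x₀) h
    simp only [mul_apply_eq_comp, _root_.sub_apply, one_apply_eq_self] at h2
    rw [sub_eq_iff_eq_add] at h2
    exact h2

theorem radial_ode {𝔸 : Type*} [NormedRing 𝔸] [NormedAlgebra ℂ 𝔸] [CompleteSpace 𝔸]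
    {M : E → E →L[ℂ] 𝔸} {M' : E → E →L[ℂ] E →L[ℂ] 𝔸} {p : E} {r : ℝ} (hr : 0 < r)
    (hM' : ContinuousOn M' (ball p r)) (hM : ∀ z ∈ ball p r, HasFDerivAt M (M' z) z) :
    ∃ δ > 0, δ ≤ r ∧ ∃ H : E → 𝔸, H p = 1 ∧ (∀ z ∈ ball p δ, DifferentiableAt ℂ H z) ∧
      ∀ z ∈ ball p δ, ∃ γ : ℝ → 𝔸, γ 0 = 1 ∧ γ 1 = H z ∧ ContinuousOn γ (Icc 0 1) ∧
        ∀ t ∈ Ico (0:ℝ) 1,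
          HasDerivWithinAt γ (M (p + (t : ℂ) • (z - p)) (z - p) * γ t) (Ici t) t := by
  have hMc : ContinuousOn M (ball p r) := fun x hx => (hM x hx).continuousAt.continuousWithinAt
  let a : E → C(I, 𝔸) := fun z => pathEval (rayPath M p z) (z - p)
  have ha : ∀ z ∈ ball p r, DifferentiableAt ℂ a z := by
    intro z hz
    have h1 := rayPath_differentiableAt hM' hM hz
    exact ((pathEval (E := E) (F := 𝔸)).differentiableAt.comp z h1).clm_apply (by fun_prop)
  let L : E → C(I, 𝔸) →L[ℂ] C(I, 𝔸) := fun z => volterra ∘L (ContinuousLinearMap.mul ℂ _ (a z))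
  have hL : ∀ z ∈ ball p r, DifferentiableAt ℂ L z := by
    intro z hz
    exact (differentiableAt_const _).clm_comp
      ((ContinuousLinearMap.mul ℂ C(I, 𝔸)).differentiableAt.comp z (ha z hz))
  have hap : a p = 0 := by simp [a]
  have hLp : L p = 0 := by
    simp [L, hap]
  obtain ⟨δ, hδ, hδr, Γ, hΓp, hΓd, hΓ⟩ := neumann_family hr hL hLp 1
  refine ⟨δ, hδ, hδr, fun z => Γ z 1, ?_, ?_, ?_⟩
  · show Γ p 1 = 1
    rw [hΓp]; rfl
  · intro z hz
    exact (ContinuousMap.evalCLM ℂ (1 : I)).differentiableAt.comp z (hΓd z hz)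
  · intro z hz
    have hzr : z ∈ ball p r := ball_subset_ball hδr hz
    have heq : Γ z = 1 + volterra (a z * Γ z) := hΓ z hz
    have hcont : Continuous (IccExtend zero_le_one (a z * Γ z)) :=
      (a z * Γ z).continuous.Icc_extend'
    let γ : ℝ → 𝔸 := fun t => 1 + ∫ s in (0:ℝ)..t, IccExtend zero_le_one (a z * Γ z) s
    have hγ : ∀ t : I, γ t = Γ z t := by
      intro t
      conv_rhs => rw [heq]
      rfl
    have hder : ∀ t, HasDerivAt γ (IccExtend zero_le_one (a z * Γ z) t) t := by
      intro t
      exact (intervalIntegral.integral_hasDerivAt_right (hcont.intervalIntegrable _ _)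
        hcont.aestronglyMeasurable.stronglyMeasurableAtFilter hcont.continuousAt).const_add 1
    refine ⟨γ, by simp [γ], hγ 1, fun t _ => (hder t).continuousAt.continuousWithinAt, ?_⟩
    intro t ht
    have ht' : t ∈ I := ⟨ht.1, ht.2.le⟩
    have h4 : IccExtend zero_le_one (a z * Γ z) t = M (p + (t : ℂ) • (z - p)) (z - p) * γ t := by
      rw [IccExtend_of_mem _ _ ht']
      have h3 := hγ ⟨t, ht'⟩
      simp only at h3
      rw [ContinuousMap.mul_apply, ← h3]
      simp only [a, pathEval_apply, rayPath_apply hMc hzr]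
    rw [← h4]
    exact (hder t).hasDerivWithinAt

theorem herm_transport {𝔸 : Type*} [NormedRing 𝔸] [NormedAlgebra ℂ 𝔸]
    [CompleteSpace 𝔸] [StarRing 𝔸] [NormedStarGroup 𝔸] [StarModule ℂ 𝔸]
    {M : E → E →L[ℂ] 𝔸} {M' : E → E →L[ℂ] E →L[ℂ] 𝔸} {P : E → 𝔸} {p : E} {r : ℝ} (hr : 0 < r)
    (hM' : ContinuousOn M' (ball p r)) (hM : ∀ z ∈ ball p r, HasFDerivAt M (M' z) z)
    (hP : ∀ z ∈ ball p r, ∀ t ∈ Icc (0:ℝ) 1, HasDerivAt (fun t : ℝ => P (p + (t : ℂ) • (z - p)))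
      (M (p + (t : ℂ) • (z - p)) (z - p) * P (p + (t : ℂ) • (z - p))
        + P (p + (t : ℂ) • (z - p)) * star (M (p + (t : ℂ) • (z - p)) (z - p))) t) :
    ∃ δ > 0, δ ≤ r ∧ ∃ H : E → 𝔸, H p = 1 ∧ (∀ z ∈ ball p δ, DifferentiableAt ℂ H z) ∧
      ∀ z ∈ ball p δ, P z = H z * P p * star (H z) := by
  have hMc : ContinuousOn M (ball p r) := fun x hx => (hM x hx).continuousAt.continuousWithinAt
  obtain ⟨δ, hδ, hδr, H, hHp, hHd, hH⟩ := radial_ode hr hM' hM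
  refine ⟨δ, hδ, hδr, H, hHp, hHd, ?_⟩
  intro z hz
  have hzr : z ∈ ball p r := ball_subset_ball hδr hz
  obtain ⟨γ, hγ0, hγ1, hγc, hγd⟩ := hH z hz
  set m : ℝ → 𝔸 := fun t => M (p + (t : ℂ) • (z - p)) (z - p) with hm
  have hmc : ContinuousOn m (Icc 0 1) := by
    have h1 : ContinuousOn (fun t : ℝ => M (p + (t : ℂ) • (z - p))) (Icc 0 1) :=
      hMc.comp (by fun_prop) (fun t ht => ray_mem hzr ⟨t, ht⟩)
    exact h1.clm_apply continuousOn_const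
  obtain ⟨K, hK⟩ := isCompact_Icc.exists_bound_of_continuousOn hmc
  have hK0 : 0 ≤ K := (norm_nonneg _).trans (hK 0 ⟨le_rfl, zero_le_one⟩)
  have hu := ODE_solution_unique_of_mem_Icc_right
    (v := fun t X => m t * X + X * star (m t)) (s := fun _ => univ) (K := ⟨2 * K, by positivity⟩)
    (f := fun t : ℝ => P (p + (t : ℂ) • (z - p))) (g := fun t => γ t * P p * star (γ t))
    (a := 0) (b := 1) ?_ ?_ ?_ ?_ ?_ ?_ ?_ ?_
  · have h := hu (x := 1) ⟨zero_le_one, le_rfl⟩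
    simpa [hγ1] using h
  · intro t ht
    apply LipschitzOnWith.of_dist_le_mul
    intro X _ Y _
    have hb := hK t ⟨ht.1, ht.2.le⟩
    rw [dist_eq_norm, dist_eq_norm]
    have e : m t * X + X * star (m t) - (m t * Y + Y * star (m t))
      = m t * (X - Y) + (X - Y) * star (m t) := by noncomm_ring
    rw [e]
    calc _ ≤ ‖m t * (X - Y)‖ + ‖(X - Y) * star (m t)‖ := norm_add_le _ _
      _ ≤ ‖m t‖ * ‖X - Y‖ + ‖X - Y‖ * ‖star (m t)‖ := add_le_add (norm_mul_le _ _) (norm_mul_le _ _)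
      _ = 2 * ‖m t‖ * ‖X - Y‖ := by rw [norm_star]; ring
      _ ≤ 2 * K * ‖X - Y‖ := by gcongr
  · intro t ht
    exact (hP z hzr t ht).continuousAt.continuousWithinAt
  · intro t ht
    exact (hP z hzr t ⟨ht.1, ht.2.le⟩).hasDerivWithinAt
  · intros; trivial
  · exact (hγc.mul continuousOn_const).mul hγc.star
  · intro t ht
    have h1 := hγd t ht
    have h2 := (h1.mul_const (P p)).mul h1.star
    refine h2.congr_deriv ?_
    show m t * γ t * P p * star (γ t) + γ t * P p * star (m t * γ t)
      = m t * (γ t * P p * star (γ t)) + γ t * P p * star (γ t) * star (m t)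
    rw [star_mul]
    noncomm_ring
  · intros; trivial
  · simp [hγ0]
end ODE

section Wirtinger
open scoped Topology ContDiff ComplexConjugate

variable {n : ℕ}

abbrev CV (n : ℕ) := EuclideanSpace ℂ (Fin n)

lemma wd_congr {f g : (CV n) → ℂ} {z : CV n} (h : f =ᶠ[𝓝 z] g) (k : Fin n) : wd k f z = wd k g z := by
  simp only [wd, h.fderiv_eq]

lemma wdb_congr {f g : (CV n) → ℂ} {z : CV n} (h : f =ᶠ[𝓝 z] g) (k : Fin n) :
    wdb k f z = wdb k g z := by
  simp only [wdb, h.fderiv_eq]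

lemma wd_congr_on {D : Set (CV n)} (hD : IsOpen D) {f g : (CV n) → ℂ} (h : ∀ z ∈ D, f z = g z)
    (k : Fin n) : ∀ z ∈ D, wd k f z = wd k g z := fun z hz =>
  wd_congr (Filter.eventuallyEq_of_mem (hD.mem_nhds hz) h) k

lemma wdb_congr_on {D : Set (CV n)} (hD : IsOpen D) {f g : (CV n) → ℂ} (h : ∀ z ∈ D, f z = g z)
    (k : Fin n) : ∀ z ∈ D, wdb k f z = wdb k g z := fun z hz =>
  wdb_congr (Filter.eventuallyEq_of_mem (hD.mem_nhds hz) h) k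

lemma wd_const (c : ℂ) (k : Fin n) (z : CV n) : wd k (fun _ => c) z = 0 := by
  simp [wd]

lemma wdb_const (c : ℂ) (k : Fin n) (z : CV n) : wdb k (fun _ => c) z = 0 := by
  simp [wdb]

lemma wd_add {f g : (CV n) → ℂ} {z : CV n} (hf : DifferentiableAt ℝ f z) (hg : DifferentiableAt ℝ g z)
    (k : Fin n) : wd k (fun w => f w + g w) z = wd k f z + wd k g z := by
  simp only [wd, fderiv_fun_add hf hg, _root_.add_apply]; ring

lemma wdb_add {f g : (CV n) → ℂ} {z : CV n} (hf : DifferentiableAt ℝ f z)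
    (hg : DifferentiableAt ℝ g z)
    (k : Fin n) : wdb k (fun w => f w + g w) z = wdb k f z + wdb k g z := by
  simp only [wdb, fderiv_fun_add hf hg, _root_.add_apply]; ring

lemma wd_sub {f g : (CV n) → ℂ} {z : CV n} (hf : DifferentiableAt ℝ f z) (hg : DifferentiableAt ℝ g z)
    (k : Fin n) : wd k (fun w => f w - g w) z = wd k f z - wd k g z := by
  simp only [wd, fderiv_fun_sub hf hg, _root_.sub_apply]; ring

lemma wdb_sub {f g : (CV n) → ℂ} {z : CV n} (hf : DifferentiableAt ℝ f z)
    (hg : DifferentiableAt ℝ g z)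
    (k : Fin n) : wdb k (fun w => f w - g w) z = wdb k f z - wdb k g z := by
  simp only [wdb, fderiv_fun_sub hf hg, _root_.sub_apply]; ring

lemma wd_neg {f : (CV n) → ℂ} {z : CV n} (k : Fin n) :
    wd k (fun w => - f w) z = - wd k f z := by
  simp only [wd, fderiv_fun_neg, _root_.neg_apply]; ring

lemma wdb_neg {f : (CV n) → ℂ} {z : CV n} (k : Fin n) :
    wdb k (fun w => - f w) z = - wdb k f z := by
  simp only [wdb, fderiv_fun_neg, _root_.neg_apply]; ring

lemma wd_mul {f g : (CV n) → ℂ} {z : CV n} (hf : DifferentiableAt ℝ f z) (hg : DifferentiableAt ℝ g z)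
    (k : Fin n) : wd k (fun w => f w * g w) z = wd k f z * g z + f z * wd k g z := by
  simp only [wd, fderiv_fun_mul hf hg, _root_.add_apply, _root_.smul_apply, smul_eq_mul]; ring

lemma wdb_mul {f g : (CV n) → ℂ} {z : CV n} (hf : DifferentiableAt ℝ f z)
    (hg : DifferentiableAt ℝ g z)
    (k : Fin n) : wdb k (fun w => f w * g w) z = wdb k f z * g z + f z * wdb k g z := by
  simp only [wdb, fderiv_fun_mul hf hg, _root_.add_apply, _root_.smul_apply, smul_eq_mul]; ring

lemma wd_sum {ι : Type*} (s : Finset ι) {f : ι → (CV n) → ℂ} {z : CV n}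
    (hf : ∀ i ∈ s, DifferentiableAt ℝ (f i) z)
    (k : Fin n) : wd k (fun w => ∑ i ∈ s, f i w) z = ∑ i ∈ s, wd k (f i) z := by
  simp only [wd, fderiv_fun_sum hf, _root_.sum_apply]
  rw [Finset.mul_sum, ← Finset.sum_sub_distrib, Finset.mul_sum]

lemma wdb_sum {ι : Type*} (s : Finset ι) {f : ι → (CV n) → ℂ} {z : CV n}
    (hf : ∀ i ∈ s, DifferentiableAt ℝ (f i) z)
    (k : Fin n) : wdb k (fun w => ∑ i ∈ s, f i w) z = ∑ i ∈ s, wdb k (f i) z := by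
  simp only [wdb, fderiv_fun_sum hf, _root_.sum_apply]
  rw [Finset.mul_sum, ← Finset.sum_add_distrib, Finset.mul_sum]

lemma fderiv_conj {f : (CV n) → ℂ} {z : CV n} (hf : DifferentiableAt ℝ f z) (v : CV n) :
    fderiv ℝ (fun w => conj (f w)) z v = conj (fderiv ℝ f z v) := by
  have h := (Complex.conjCLE.toContinuousLinearMap.hasFDerivAt (x := f z)).comp z hf.hasFDerivAt
  have h2 : HasFDerivAt (fun w => conj (f w)) _ z := h
  rw [h2.fderiv]
  simp

lemma wd_conj {f : (CV n) → ℂ} {z : CV n} (hf : DifferentiableAt ℝ f z) (k : Fin n) :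
    wd k (fun w => conj (f w)) z = conj (wdb k f z) := by
  simp only [wd, wdb, fderiv_conj hf, map_mul, map_add, Complex.conj_I]
  simp only [map_div₀, map_one, map_ofNat]; ring

lemma wdb_conj {f : (CV n) → ℂ} {z : CV n} (hf : DifferentiableAt ℝ f z) (k : Fin n) :
    wdb k (fun w => conj (f w)) z = conj (wd k f z) := by
  simp only [wd, wdb, fderiv_conj hf, map_mul, map_sub, Complex.conj_I]
  simp only [map_div₀, map_one, map_ofNat]; ring

/-- real total derivative in terms of Wirtinger derivatives -/
lemma fderiv_eq_wd (f : (CV n) → ℂ) (z v : CV n) :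
    fderiv ℝ f z v = ∑ k, (v k * wd k f z + conj (v k) * wdb k f z) := by
  have hv : v = ∑ k, ((v k).re • (EuclideanSpace.single k 1 : CV n)
      + (v k).im • (EuclideanSpace.single k Complex.I : CV n)) := by
    ext j
    simp [Finset.sum_add_distrib, Pi.single_apply]
  conv_lhs => rw [hv]
  rw [map_sum]
  refine Finset.sum_congr rfl fun k _ => ?_
  rw [map_add, map_smul, map_smul]
  simp only [wd, wdb, Complex.real_smul]
  have h1 : v k = (v k).re + (v k).im * Complex.I := (Complex.re_add_im _).symm
  have h2 : conj (v k) = (v k).re - (v k).im * Complex.I := by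
    apply Complex.ext <;> simp
  rw [h2]
  conv_rhs => rw [h1]
  simp only [Complex.add_re, Complex.ofReal_re, Complex.mul_re, Complex.I_re, mul_zero,
    Complex.ofReal_im, Complex.I_im, mul_one, sub_self, add_zero, Complex.add_im, Complex.mul_im,
    zero_add]
  linear_combination ((v k).im * fderiv ℝ f z (EuclideanSpace.single k Complex.I)) * Complex.I_sq

lemma wdb_of_holo {f : (CV n) → ℂ} {z : CV n} (hf : DifferentiableAt ℂ f z) (k : Fin n) :
    wdb k f z = 0 := by
  have e : (EuclideanSpace.single k Complex.I : CV n) = Complex.I • EuclideanSpace.single k 1 := by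
    ext j; simp [Pi.single_apply]
  rw [wdb, hf.fderiv_restrictScalars ℝ, e]
  simp only [ContinuousLinearMap.coe_restrictScalars', map_smul, smul_eq_mul]
  linear_combination (1/2 * fderiv ℂ f z (EuclideanSpace.single k 1)) * Complex.I_sq

lemma holo_of_wdb {f : (CV n) → ℂ} {z : CV n} (hf : DifferentiableAt ℝ f z)
    (h : ∀ k, wdb k f z = 0) :
    HasFDerivAt f (∑ k, wd k f z • (EuclideanSpace.proj k : (CV n) →L[ℂ] ℂ)) z := by
  refine hasFDerivAt_of_restrictScalars ℝ hf.hasFDerivAt ?_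
  ext v
  rw [fderiv_eq_wd]
  simp [h, mul_comm]

lemma ContDiffOn.wd' {D : Set (CV n)} (hD : IsOpen D) {f : (CV n) → ℂ} (hf : ContDiffOn ℝ ∞ f D)
    (k : Fin n) : ContDiffOn ℝ ∞ (wd k f) D := by
  have h := hf.fderiv_of_isOpen hD (m := ∞) (by simp)
  have h1 := h.clm_apply (contDiffOn_const (c := (EuclideanSpace.single k 1 : CV n)))
  have h2 := h.clm_apply (contDiffOn_const (c := (EuclideanSpace.single k Complex.I : CV n)))
  exact contDiffOn_const.mul (h1.sub (contDiffOn_const.mul h2))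

lemma ContDiffOn.wdb' {D : Set (CV n)} (hD : IsOpen D) {f : (CV n) → ℂ} (hf : ContDiffOn ℝ ∞ f D)
    (k : Fin n) : ContDiffOn ℝ ∞ (wdb k f) D := by
  have h := hf.fderiv_of_isOpen hD (m := ∞) (by simp)
  have h1 := h.clm_apply (contDiffOn_const (c := (EuclideanSpace.single k 1 : CV n)))
  have h2 := h.clm_apply (contDiffOn_const (c := (EuclideanSpace.single k Complex.I : CV n)))
  exact contDiffOn_const.mul (h1.add (contDiffOn_const.mul h2))

lemma ContDiffOn.dAt {D : Set (CV n)} (hD : IsOpen D) {f : (CV n) → ℂ} (hf : ContDiffOn ℝ ∞ f D)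
    {z : CV n} (hz : z ∈ D) : DifferentiableAt ℝ f z :=
  (hf.contDiffAt (hD.mem_nhds hz)).differentiableAt (by simp)

lemma wd_wdb_comm {D : Set (CV n)} (hD : IsOpen D) {f : (CV n) → ℂ} (hf : ContDiffOn ℝ ∞ f D)
    {z : CV n} (hz : z ∈ D) (k l : Fin n) : wd k (wdb l f) z = wdb l (wd k f) z := by
  have hc := hf.contDiffAt (hD.mem_nhds hz)
  have hs : IsSymmSndFDerivAt ℝ f z := hc.isSymmSndFDerivAt (by simp; norm_cast)
  have hd : DifferentiableAt ℝ (fderiv ℝ f) z :=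
    (hc.fderiv_right (m := 1) (by norm_cast)).differentiableAt (by simp)
  have hd1 : ∀ v : CV n, DifferentiableAt ℝ (fun w => fderiv ℝ f w v) z :=
    fun v => hd.clm_apply (differentiableAt_const _)
  have hfd : ∀ v w : CV n, fderiv ℝ (fun x => fderiv ℝ f x v) z w = fderiv ℝ (fderiv ℝ f) z w v := by
    intro v w
    rw [fderiv_clm_apply hd (differentiableAt_const _)]
    simp
  have e1 : ∀ w : CV n, fderiv ℝ (wdb l f) z w = (1/2 : ℂ) *
      (fderiv ℝ (fderiv ℝ f) z w (EuclideanSpace.single l 1)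
        + Complex.I * fderiv ℝ (fderiv ℝ f) z w (EuclideanSpace.single l Complex.I)) := by
    intro w
    have : wdb l f = fun z => (1/2 : ℂ) * (fderiv ℝ f z (EuclideanSpace.single l 1)
      + Complex.I * fderiv ℝ f z (EuclideanSpace.single l Complex.I)) := rfl
    rw [this, fderiv_const_mul ((hd1 _).fun_add ((hd1 _).const_mul _)),
      fderiv_fun_add (hd1 _) ((hd1 _).const_mul _), fderiv_const_mul (hd1 _)]
    simp only [_root_.smul_apply, _root_.add_apply, hfd, smul_eq_mul]
  have e2 : ∀ w : CV n, fderiv ℝ (wd k f) z w = (1/2 : ℂ) *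
      (fderiv ℝ (fderiv ℝ f) z w (EuclideanSpace.single k 1)
        - Complex.I * fderiv ℝ (fderiv ℝ f) z w (EuclideanSpace.single k Complex.I)) := by
    intro w
    have : wd k f = fun z => (1/2 : ℂ) * (fderiv ℝ f z (EuclideanSpace.single k 1)
      - Complex.I * fderiv ℝ f z (EuclideanSpace.single k Complex.I)) := rfl
    rw [this, fderiv_const_mul ((hd1 _).fun_sub ((hd1 _).const_mul _)),
      fderiv_fun_sub (hd1 _) ((hd1 _).const_mul _), fderiv_const_mul (hd1 _)]
    simp only [_root_.smul_apply, _root_.sub_apply, hfd, smul_eq_mul]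
  rw [wd, wdb, e1, e1, e2, e2]
  rw [hs (EuclideanSpace.single k 1) (EuclideanSpace.single l 1),
    hs (EuclideanSpace.single k 1) (EuclideanSpace.single l Complex.I),
    hs (EuclideanSpace.single k Complex.I) (EuclideanSpace.single l 1),
    hs (EuclideanSpace.single k Complex.I) (EuclideanSpace.single l Complex.I)]
  ring

lemma wd_comp_holo {F : ℂ → ℂ} {F' : ℂ} {f : (CV n) → ℂ} {z : CV n} (hf : DifferentiableAt ℝ f z)
    (hF : HasDerivAt F F' (f z)) (k : Fin n) : wd k (fun w => F (f w)) z = F' * wd k f z := by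
  have h : HasFDerivAt (fun w => F (f w)) (F' • fderiv ℝ f z) z := by
    have := (hF.hasFDerivAt.restrictScalars ℝ).comp z hf.hasFDerivAt
    refine this.congr_fderiv ?_
    ext v
    simp [mul_comm]
  simp only [wd, h.fderiv, _root_.smul_apply, smul_eq_mul]
  ring

end Wirtinger

section Geometry
open scoped Topology ContDiff ComplexConjugate

variable {n : ℕ}

lemma contDiffOn_det {m : Type*} [Fintype m] [DecidableEq m] {D : Set (CV n)}
    {A : CV n → Matrix m m ℂ} (hA : ∀ i j, ContDiffOn ℝ ∞ (fun z => A z i j) D) :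
    ContDiffOn ℝ ∞ (fun z => (A z).det) D := by
  simp only [Matrix.det_apply']
  refine ContDiffOn.sum fun σ _ => contDiffOn_const.mul ?_
  exact contDiffOn_prod fun i _ => hA _ _

lemma contDiffOn_inv_entry {m : Type*} [Fintype m] [DecidableEq m] {D : Set (CV n)}
    {A : CV n → Matrix m m ℂ} (hA : ∀ i j, ContDiffOn ℝ ∞ (fun z => A z i j) D)
    (hdet : ∀ z ∈ D, (A z).det ≠ 0) (i j : m) :
    ContDiffOn ℝ ∞ (fun z => (A z)⁻¹ i j) D := by
  have h : (fun z => (A z)⁻¹ i j) = fun z => ((A z).det)⁻¹ * (A z).adjugate i j := by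
    funext z
    rw [Matrix.inv_def, Ring.inverse_eq_inv']
    rfl
  rw [h]
  refine ((contDiffOn_det hA).inv hdet).mul ?_
  simp only [Matrix.adjugate_apply]
  apply contDiffOn_det
  intro a b
  simp only [Matrix.updateRow_apply]
  split_ifs
  · exact contDiffOn_const
  · exact hA _ _

/-- Kronecker delta -/
def kd (i j : Fin n) : ℂ := if i = j then 1 else 0

lemma sum_kd_mul (i : Fin n) (f : Fin n → ℂ) : ∑ k, kd i k * f k = f i := by
  simp [kd]

def Gi (φ : CV n → ℝ) (q k : Fin n) (z : CV n) : ℂ := (Matrix.of fun i j => gmat φ i j z)⁻¹ q k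

def Gam (φ : CV n → ℝ) (i j k : Fin n) (z : CV n) : ℂ := ∑ q, wd i (gmat φ j q) z * Gi φ q k z

def fi (φ : CV n → ℝ) (j : Fin n) : CV n → ℂ := wd j (fun w => (φ w : ℂ))

def Aco (φ : CV n → ℝ) (i j k : Fin n) (z : CV n) : ℂ :=
  Gam φ i j k z - kd i k * fi φ j z - kd j k * fi φ i z

def Bco (φ : CV n → ℝ) (i j : Fin n) (z : CV n) : ℂ :=
  - wd i (fi φ j) z + ∑ k, Gam φ i j k z * fi φ k z - fi φ i z * fi φ j z

def uu (φ : CV n → ℝ) (z : CV n) : ℂ := Complex.exp (-(φ z : ℂ))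

variable {φ : CV n → ℝ} {D : Set (CV n)}

lemma sm_phi (hφ : ContDiffOn ℝ ∞ φ D) : ContDiffOn ℝ ∞ (fun w => (φ w : ℂ)) D :=
  Complex.ofRealCLM.contDiff.comp_contDiffOn hφ

lemma sm_fi (hD : IsOpen D) (hφ : ContDiffOn ℝ ∞ φ D) (j : Fin n) : ContDiffOn ℝ ∞ (fi φ j) D :=
  (sm_phi hφ).wd' hD j

lemma sm_g (hD : IsOpen D) (hφ : ContDiffOn ℝ ∞ φ D) (i j : Fin n) :
    ContDiffOn ℝ ∞ (gmat φ i j) D :=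
  ((sm_phi hφ).wdb' hD j).wd' hD i

lemma sm_Gi (hD : IsOpen D) (hφ : ContDiffOn ℝ ∞ φ D)
    (hpos : ∀ z ∈ D, (Matrix.of fun i j => gmat φ i j z).PosDef) (q k : Fin n) :
    ContDiffOn ℝ ∞ (Gi φ q k) D :=
  contDiffOn_inv_entry (A := fun z => Matrix.of fun i j => gmat φ i j z)
    (fun i j => sm_g hD hφ i j) (fun z hz => (hpos z hz).det_pos.ne') q k

lemma sm_Gam (hD : IsOpen D) (hφ : ContDiffOn ℝ ∞ φ D)
    (hpos : ∀ z ∈ D, (Matrix.of fun i j => gmat φ i j z).PosDef) (i j k : Fin n) :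
    ContDiffOn ℝ ∞ (Gam φ i j k) D :=
  ContDiffOn.sum fun q _ => ((sm_g hD hφ j q).wd' hD i).mul (sm_Gi hD hφ hpos q k)

lemma sm_Aco (hD : IsOpen D) (hφ : ContDiffOn ℝ ∞ φ D)
    (hpos : ∀ z ∈ D, (Matrix.of fun i j => gmat φ i j z).PosDef) (i j k : Fin n) :
    ContDiffOn ℝ ∞ (Aco φ i j k) D :=
  ((sm_Gam hD hφ hpos i j k).sub (contDiffOn_const.mul (sm_fi hD hφ j))).sub
    (contDiffOn_const.mul (sm_fi hD hφ i))

lemma sm_Bco (hD : IsOpen D) (hφ : ContDiffOn ℝ ∞ φ D)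
    (hpos : ∀ z ∈ D, (Matrix.of fun i j => gmat φ i j z).PosDef) (i j : Fin n) :
    ContDiffOn ℝ ∞ (Bco φ i j) D :=
  (((sm_fi hD hφ j).wd' hD i).neg.add (ContDiffOn.sum fun k _ =>
    (sm_Gam hD hφ hpos i j k).mul (sm_fi hD hφ k))).sub ((sm_fi hD hφ i).mul (sm_fi hD hφ j))

lemma sm_uu (hφ : ContDiffOn ℝ ∞ φ D) : ContDiffOn ℝ ∞ (uu φ) D :=
  (sm_phi hφ).neg.cexp

lemma Gi_mul_g (hpos : ∀ z ∈ D, (Matrix.of fun i j => gmat φ i j z).PosDef) {z : CV n} (hz : z ∈ D)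
    (q l : Fin n) : ∑ k, Gi φ q k z * gmat φ k l z = kd q l := by
  have hu : IsUnit (Matrix.of fun i j => gmat φ i j z).det :=
    (hpos z hz).det_pos.ne'.isUnit
  have h := congrFun (congrFun (Matrix.nonsing_inv_mul _ hu) q) l
  rw [Matrix.mul_apply, Matrix.one_apply] at h
  exact h

lemma g_mul_Gi (hpos : ∀ z ∈ D, (Matrix.of fun i j => gmat φ i j z).PosDef) {z : CV n} (hz : z ∈ D)
    (q l : Fin n) : ∑ k, gmat φ q k z * Gi φ k l z = kd q l := by
  have hu : IsUnit (Matrix.of fun i j => gmat φ i j z).det :=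
    (hpos z hz).det_pos.ne'.isUnit
  have h := congrFun (congrFun (Matrix.mul_nonsing_inv _ hu) q) l
  rw [Matrix.mul_apply, Matrix.one_apply] at h
  exact h

lemma Gam_mul_g (hpos : ∀ z ∈ D, (Matrix.of fun i j => gmat φ i j z).PosDef) {z : CV n} (hz : z ∈ D)
    (i j l : Fin n) : ∑ k, Gam φ i j k z * gmat φ k l z = wd i (gmat φ j l) z := by
  simp only [Gam, Finset.sum_mul]
  rw [Finset.sum_comm]
  simp only [mul_assoc, ← Finset.mul_sum, Gi_mul_g hpos hz]
  simp [kd]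

lemma wdb_Gam (hD : IsOpen D) (hφ : ContDiffOn ℝ ∞ φ D)
    (hpos : ∀ z ∈ D, (Matrix.of fun i j => gmat φ i j z).PosDef)
    (hchsc : ∀ z ∈ D, ∀ i j k l : Fin n, Riem (gmat φ) i j k l z
        = -(gmat φ i j z * gmat φ k l z + gmat φ i l z * gmat φ k j z))
    {z : CV n} (hz : z ∈ D) (i j k l : Fin n) :
    wdb l (Gam φ i j k) z = kd j k * gmat φ i l z + kd i k * gmat φ j l z := by
  have dGam : ∀ i j k, DifferentiableAt ℝ (Gam φ i j k) z :=
    fun i j k => (sm_Gam hD hφ hpos i j k).dAt hD hz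
  have dg : ∀ i j, DifferentiableAt ℝ (gmat φ i j) z := fun i j => (sm_g hD hφ i j).dAt hD hz
  have key : ∀ m, ∑ k, wdb l (Gam φ i j k) z * gmat φ k m z
      = gmat φ j m z * gmat φ i l z + gmat φ j l z * gmat φ i m z := by
    intro m
    have h1 := wdb_congr_on hD (fun z hz => Gam_mul_g hpos hz i j m) l z hz
    rw [wdb_sum _ (fun k _ => (dGam i j k).fun_mul (dg k m)),
      ← wd_wdb_comm hD (sm_g hD hφ j m) hz] at h1
    simp only [wdb_mul (dGam i j _) (dg _ m), Finset.sum_add_distrib] at h1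
    have h2 := hchsc z hz j m i l
    have h3 : ∑ p, ∑ q, ginv (gmat φ) z p q * wdb l (gmat φ p m) z * wd i (gmat φ j q) z
        = ∑ k, Gam φ i j k z * wdb l (gmat φ k m) z := by
      refine Finset.sum_congr rfl fun p _ => ?_
      rw [Gam, Finset.sum_mul]
      refine Finset.sum_congr rfl fun q _ => ?_
      have : ginv (gmat φ) z p q = Gi φ q p z := rfl
      rw [this]; ring
    rw [Riem, h3] at h2
    linear_combination h1 - h2
  have h4 : wdb l (Gam φ i j k) z
      = ∑ m, (∑ k', wdb l (Gam φ i j k') z * gmat φ k' m z) * Gi φ m k z := by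
    simp only [Finset.sum_mul]
    rw [Finset.sum_comm]
    simp only [mul_assoc, ← Finset.mul_sum, g_mul_Gi hpos hz]
    simp [kd]
  rw [h4]
  simp only [key, add_mul, Finset.sum_add_distrib]
  have e1 := g_mul_Gi hpos hz j k
  have e2 := g_mul_Gi hpos hz i k
  rw [← e1, ← e2, Finset.sum_mul, Finset.sum_mul]
  congr 1 <;> refine Finset.sum_congr rfl fun m _ => ?_ <;> ring

lemma wdb_fi (hD : IsOpen D) (hφ : ContDiffOn ℝ ∞ φ D) {z : CV n} (hz : z ∈ D) (j l : Fin n) :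
    wdb l (fi φ j) z = gmat φ j l z :=
  (wd_wdb_comm hD (sm_phi hφ) hz j l).symm

lemma wdb_cmul {f : CV n → ℂ} {z : CV n} (hf : DifferentiableAt ℝ f z) (c : ℂ) (k : Fin n) :
    wdb k (fun w => c * f w) z = c * wdb k f z := by
  rw [wdb_mul (differentiableAt_const c) hf, wdb_const]; ring

lemma wdb_Aco (hD : IsOpen D) (hφ : ContDiffOn ℝ ∞ φ D)
    (hpos : ∀ z ∈ D, (Matrix.of fun i j => gmat φ i j z).PosDef)
    (hchsc : ∀ z ∈ D, ∀ i j k l : Fin n, Riem (gmat φ) i j k l z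
        = -(gmat φ i j z * gmat φ k l z + gmat φ i l z * gmat φ k j z))
    {z : CV n} (hz : z ∈ D) (i j k l : Fin n) : wdb l (Aco φ i j k) z = 0 := by
  have dGam := (sm_Gam hD hφ hpos i j k).dAt hD hz
  have dfi : ∀ i, DifferentiableAt ℝ (fi φ i) z := fun i => (sm_fi hD hφ i).dAt hD hz
  have e : Aco φ i j k = fun z => Gam φ i j k z - kd i k * fi φ j z - kd j k * fi φ i z := rfl
  rw [e, wdb_sub (dGam.fun_sub ((dfi j).const_mul _)) ((dfi i).const_mul _),
    wdb_sub dGam ((dfi j).const_mul _), wdb_cmul (dfi j), wdb_cmul (dfi i),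
    wdb_Gam hD hφ hpos hchsc hz, wdb_fi hD hφ hz, wdb_fi hD hφ hz]
  ring

lemma wdb_Bco (hD : IsOpen D) (hφ : ContDiffOn ℝ ∞ φ D)
    (hpos : ∀ z ∈ D, (Matrix.of fun i j => gmat φ i j z).PosDef)
    (hchsc : ∀ z ∈ D, ∀ i j k l : Fin n, Riem (gmat φ) i j k l z
        = -(gmat φ i j z * gmat φ k l z + gmat φ i l z * gmat φ k j z))
    {z : CV n} (hz : z ∈ D) (i j l : Fin n) : wdb l (Bco φ i j) z = 0 := by
  have dGam : ∀ k, DifferentiableAt ℝ (Gam φ i j k) z :=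
    fun k => (sm_Gam hD hφ hpos i j k).dAt hD hz
  have dfi : ∀ i, DifferentiableAt ℝ (fi φ i) z := fun i => (sm_fi hD hφ i).dAt hD hz
  have dwfi := ((sm_fi hD hφ j).wd' hD i).dAt hD hz
  have dS : DifferentiableAt ℝ (fun z => ∑ k, Gam φ i j k z * fi φ k z) z :=
    DifferentiableAt.fun_sum fun k _ => (dGam k).fun_mul (dfi k)
  have e : Bco φ i j = fun z => - wd i (fi φ j) z + ∑ k, Gam φ i j k z * fi φ k z
    - fi φ i z * fi φ j z := rfl
  rw [e, wdb_sub (dwfi.fun_neg.fun_add dS) ((dfi i).fun_mul (dfi j)), wdb_add dwfi.fun_neg dS,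
    wdb_neg, wdb_sum _ (fun k _ => (dGam k).fun_mul (dfi k)), wdb_mul (dfi i) (dfi j),
    ← wd_wdb_comm hD (sm_fi hD hφ j) hz,
    wd_congr_on hD (fun z hz => wdb_fi hD hφ hz j l) i z hz]
  simp only [wdb_mul (dGam _) (dfi _), wdb_Gam hD hφ hpos hchsc hz, wdb_fi hD hφ hz,
    Finset.sum_add_distrib, Gam_mul_g hpos hz, add_mul]
  have e1 : ∑ x, kd j x * gmat φ i l z * fi φ x z = gmat φ i l z * fi φ j z := by
    rw [← sum_kd_mul j (fun x => gmat φ i l z * fi φ x z)]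
    exact Finset.sum_congr rfl fun _ _ => by ring
  have e2 : ∑ x, kd i x * gmat φ j l z * fi φ x z = gmat φ j l z * fi φ i z := by
    rw [← sum_kd_mul i (fun x => gmat φ j l z * fi φ x z)]
    exact Finset.sum_congr rfl fun _ _ => by ring
  rw [e1, e2]
  ring

lemma wd_uu (hD : IsOpen D) (hφ : ContDiffOn ℝ ∞ φ D) {z : CV n} (hz : z ∈ D) (k : Fin n) :
    wd k (uu φ) z = -(fi φ k z * uu φ z) := by
  have dn := ((sm_phi hφ).dAt hD hz).fun_neg
  have h := wd_comp_holo dn (Complex.hasDerivAt_exp _) k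
  have e : uu φ = fun w => Complex.exp (-(φ w : ℂ)) := rfl
  rw [e, h, wd_neg]
  simp only [fi]; ring

/-- the second order system -/
def Sys (φ : CV n → ℝ) (D : Set (CV n)) (v : CV n → ℂ) : Prop :=
  ∀ z ∈ D, ∀ i j, wd i (wd j v) z = Bco φ i j z * v z + ∑ k, Aco φ i j k z * wd k v z

lemma sys_uu (hD : IsOpen D) (hφ : ContDiffOn ℝ ∞ φ D) : Sys φ D (uu φ) := by
  intro z hz i j
  have dfi : ∀ i, DifferentiableAt ℝ (fi φ i) z := fun i => (sm_fi hD hφ i).dAt hD hz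
  have du := (sm_uu hφ).dAt hD hz
  rw [wd_congr_on hD (fun z hz => wd_uu hD hφ hz j) i z hz, wd_neg, wd_mul (dfi j) du]
  simp only [wd_uu hD hφ hz, Bco, Aco, sub_mul, Finset.sum_sub_distrib]
  have e1 : ∑ x, kd j x * fi φ i z * -(fi φ x z * uu φ z) = -(fi φ i z * fi φ j z * uu φ z) := by
    have := sum_kd_mul j (fun x => fi φ i z * -(fi φ x z * uu φ z))
    simp only [← mul_assoc] at this ⊢
    rw [this]; ring
  have e2 : ∑ x, kd i x * fi φ j z * -(fi φ x z * uu φ z) = -(fi φ j z * fi φ i z * uu φ z) := by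
    have := sum_kd_mul i (fun x => fi φ j z * -(fi φ x z * uu φ z))
    simp only [← mul_assoc] at this ⊢
    rw [this]; ring
  have e3 : ∑ x, Gam φ i j x z * -(fi φ x z * uu φ z)
      = -((∑ x, Gam φ i j x z * fi φ x z) * uu φ z) := by
    rw [Finset.sum_mul, ← Finset.sum_neg_distrib]
    exact Finset.sum_congr rfl fun _ _ => by ring
  rw [e1, e2, e3]
  ring

lemma Sys.wdb (hD : IsOpen D) (hφ : ContDiffOn ℝ ∞ φ D)
    (hpos : ∀ z ∈ D, (Matrix.of fun i j => gmat φ i j z).PosDef)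
    (hchsc : ∀ z ∈ D, ∀ i j k l : Fin n, Riem (gmat φ) i j k l z
        = -(gmat φ i j z * gmat φ k l z + gmat φ i l z * gmat φ k j z))
    {v : CV n → ℂ} (hv : ContDiffOn ℝ ∞ v D) (h : Sys φ D v) (l : Fin n) :
    Sys φ D (wdb l v) := by
  intro z hz i j
  have dv := hv.dAt hD hz
  have dwv : ∀ k, DifferentiableAt ℝ (wd k v) z := fun k => (hv.wd' hD k).dAt hD hz
  have dA : ∀ k, DifferentiableAt ℝ (Aco φ i j k) z := fun k => (sm_Aco hD hφ hpos i j k).dAt hD hz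
  have dB := (sm_Bco hD hφ hpos i j).dAt hD hz
  have h1 := wdb_congr_on hD (fun z hz => h z hz i j) l z hz
  rw [← wd_wdb_comm hD (hv.wd' hD j) hz,
    ← wd_congr_on hD (fun z hz => wd_wdb_comm hD hv hz j l) i z hz,
    wdb_add (dB.fun_mul dv) (DifferentiableAt.fun_sum fun k _ => (dA k).fun_mul (dwv k)),
    wdb_mul dB dv, wdb_sum _ (fun k _ => (dA k).fun_mul (dwv k)),
    wdb_Bco hD hφ hpos hchsc hz] at h1
  rw [h1, zero_mul, zero_add]
  congr 1
  refine Finset.sum_congr rfl fun k _ => ?_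
  rw [wdb_mul (dA k) (dwv k), wdb_Aco hD hφ hpos hchsc hz, wd_wdb_comm hD hv hz]
  ring

end Geometry

section Transport
open scoped Topology ContDiff ComplexConjugate

variable {n : ℕ}

lemma holo_sum {F : Type*} [NormedAddCommGroup F] [NormedSpace ℂ F] {S : Type*} [Fintype S]
    (T : S → F) {c : S → CV n → ℂ} {D : Set (CV n)} (hD : IsOpen D)
    (hc : ∀ s, ContDiffOn ℝ ∞ (c s) D) (hcb : ∀ z ∈ D, ∀ l s, wdb l (c s) z = 0) :
    ∃ M' : CV n → CV n →L[ℂ] F, ContinuousOn M' D ∧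
      ∀ z ∈ D, HasFDerivAt (fun z => ∑ s, c s z • T s) (M' z) z := by
  refine ⟨fun z => ∑ s, (∑ k, wd k (c s) z • (EuclideanSpace.proj k : CV n →L[ℂ] ℂ)).smulRight (T s),
    ?_, ?_⟩
  · refine continuousOn_finsetSum _ fun s _ => ?_
    have h : ContinuousOn (fun z => ∑ k, wd k (c s) z • (EuclideanSpace.proj k : CV n →L[ℂ] ℂ)) D :=
      continuousOn_finsetSum _ fun k _ => ((hc s).wd' hD k).continuousOn.smul continuousOn_const
    exact (ContinuousLinearMap.smulRightL ℂ (CV n) F).flip (T s) |>.continuous.comp_continuousOn h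
  · intro z hz
    refine HasFDerivAt.fun_sum fun s _ => ?_
    exact (holo_of_wdb ((hc s).dAt hD hz) fun k => hcb z hz k s).smul_const _

lemma transport_aux {𝔸 : Type*} [NormedRing 𝔸] [NormedAlgebra ℂ 𝔸] [CompleteSpace 𝔸] [StarRing 𝔸]
    [NormedStarGroup 𝔸] [StarModule ℂ 𝔸] {S : Type*} [Fintype S] (e : S → 𝔸)
    {q : S → CV n → ℂ} {c : Fin n → S → CV n → ℂ}
    {D : Set (CV n)} (hD : IsOpen D) {p : CV n} (hp : p ∈ D)
    (hq : ∀ s, ContDiffOn ℝ ∞ (q s) D) (hc : ∀ i s, ContDiffOn ℝ ∞ (c i s) D)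
    (hcb : ∀ z ∈ D, ∀ l i s, wdb l (c i s) z = 0)
    (hw : ∀ z ∈ D, ∀ i, ∑ s, wd i (q s) z • e s = (∑ s, c i s z • e s) * ∑ s, q s z • e s)
    (hwb : ∀ z ∈ D, ∀ i, ∑ s, wdb i (q s) z • e s
      = (∑ s, q s z • e s) * star (∑ s, c i s z • e s)) :
    ∃ δ > 0, Metric.ball p δ ⊆ D ∧ ∃ H : CV n → 𝔸, H p = 1 ∧
      (∀ z ∈ Metric.ball p δ, DifferentiableAt ℂ H z) ∧
      ∀ z ∈ Metric.ball p δ, ∑ s, q s z • e s = H z * (∑ s, q s p • e s) * star (H z) := by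
  obtain ⟨r, hr, hrD⟩ := Metric.isOpen_iff.1 hD p hp
  let T : Fin n × S → (CV n →L[ℂ] 𝔸) := fun s =>
    (EuclideanSpace.proj s.1 : CV n →L[ℂ] ℂ).smulRight (e s.2)
  let M : CV n → CV n →L[ℂ] 𝔸 := fun z => ∑ s : Fin n × S, c s.1 s.2 z • T s
  have hMapp : ∀ z v, M z v = ∑ i, v i • ∑ s, c i s z • e s := by
    intro z v
    simp only [M, T, _root_.sum_apply, Finset.smul_sum]
    rw [Fintype.sum_prod_type]
    refine Finset.sum_congr rfl fun i _ => Finset.sum_congr rfl fun s _ => ?_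
    exact smul_comm _ _ _
  obtain ⟨M', hM'c, hM'⟩ := holo_sum T (c := fun s => c s.1 s.2) hD (fun s => hc _ _)
    (fun z hz l s => hcb z hz l _ _)
  have hT := herm_transport (M := M) (M' := M') (P := fun z => ∑ s, q s z • e s)
    (p := p) hr (hM'c.mono hrD) (fun z hz => hM' z (hrD hz)) ?_
  · obtain ⟨δ, hδ, hδr, H, h1, h2, h3⟩ := hT
    exact ⟨δ, hδ, (Metric.ball_subset_ball hδr).trans hrD, H, h1, h2, h3⟩
  · intro z hz t ht
    have hy : p + (t : ℂ) • (z - p) ∈ D := by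
      apply hrD
      rw [Metric.mem_ball, dist_eq_norm] at hz ⊢
      rw [add_sub_cancel_left, norm_smul, Complex.norm_real, Real.norm_of_nonneg ht.1]
      nlinarith [norm_nonneg (z - p), ht.2]
    have hray : HasDerivAt (fun t : ℝ => p + (t : ℂ) • (z - p)) (z - p) t := by
      have h := ((Complex.ofRealCLM.hasDerivAt (x := t)).smul_const (z - p)).const_add p
      simpa using h
    have hd : HasDerivAt (fun t : ℝ => ∑ s, q s (p + (t : ℂ) • (z - p)) • e s)
        (∑ s, (fderiv ℝ (q s) (p + (t : ℂ) • (z - p)) (z - p)) • e s) t := by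
      refine HasDerivAt.fun_sum fun s _ => ?_
      have h1 := (((hq s).dAt hD hy).hasFDerivAt.comp_hasDerivAt t hray)
      exact h1.smul_const _
    refine hd.congr_deriv ?_
    set y := p + (t : ℂ) • (z - p)
    set v := z - p
    rw [hMapp]
    simp only [fderiv_eq_wd, Finset.sum_add_distrib, add_smul, Finset.sum_smul, star_sum, star_smul]
    rw [Finset.sum_mul, Finset.mul_sum, Finset.sum_comm]
    congr 1
    · refine Finset.sum_congr rfl fun i _ => ?_
      rw [smul_mul_assoc, ← hw y hy i, Finset.smul_sum]
      simp only [mul_smul]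
    · rw [Finset.sum_comm]
      refine Finset.sum_congr rfl fun i _ => ?_
      have := hwb y hy i
      simp only [star_sum, star_smul] at this
      rw [mul_smul_comm, ← this, Finset.smul_sum]
      simp only [mul_smul, Complex.star_def]

open scoped Matrix.Norms.L2Operator

lemma transport {m : Type} [Fintype m] [DecidableEq m] {P : m → m → CV n → ℂ}
    {mm : Fin n → m → m → CV n → ℂ} {D : Set (CV n)} (hD : IsOpen D) {p : CV n} (hp : p ∈ D)
    (hP : ∀ a b, ContDiffOn ℝ ∞ (P a b) D) (hm : ∀ i a b, ContDiffOn ℝ ∞ (mm i a b) D)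
    (hmb : ∀ z ∈ D, ∀ l i a b, wdb l (mm i a b) z = 0)
    (hw : ∀ z ∈ D, ∀ i a b, wd i (P a b) z = ∑ c, mm i a c z * P c b z)
    (hwb : ∀ z ∈ D, ∀ i a b, wdb i (P a b) z = ∑ c, P a c z * conj (mm i b c z)) :
    ∃ δ > 0, Metric.ball p δ ⊆ D ∧ ∃ H : CV n → Matrix m m ℂ,
      (∀ a b, ∀ z ∈ Metric.ball p δ, DifferentiableAt ℂ (fun z => H z a b) z) ∧ H p = 1 ∧
      ∀ z ∈ Metric.ball p δ, (Matrix.of fun a b => P a b z)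
        = H z * (Matrix.of fun a b => P a b p) * (H z)ᴴ := by
  have hmat : ∀ f : m → m → ℂ, ∑ s : m × m, f s.1 s.2 • Matrix.single s.1 s.2 (1 : ℂ)
      = Matrix.of f := by
    intro f
    conv_rhs => rw [Matrix.matrix_eq_sum_single (Matrix.of f)]
    simp [Matrix.smul_single, Fintype.sum_prod_type]
  obtain ⟨δ, hδ, hδD, H, h1, h2, h3⟩ := transport_aux
    (fun s : m × m => Matrix.single s.1 s.2 (1 : ℂ)) (q := fun s => P s.1 s.2)
    (c := fun i s => mm i s.1 s.2) hD hp (fun s => hP _ _) (fun i s => hm _ _ _)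
    (fun z hz l i s => hmb z hz l i _ _) (fun z hz i => by
      rw [hmat (fun a b => wd i (P a b) z), hmat (fun a b => mm i a b z), hmat (fun a b => P a b z)]
      ext a b
      simp [Matrix.mul_apply, hw z hz]) (fun z hz i => by
      rw [hmat (fun a b => wdb i (P a b) z), hmat (fun a b => mm i a b z), hmat (fun a b => P a b z)]
      ext a b
      simp [Matrix.mul_apply, hwb z hz])
  refine ⟨δ, hδ, hδD, H, ?_, h1, ?_⟩
  · intro a b z hz
    have := (LinearMap.toContinuousLinearMap (Matrix.entryLinearMap ℂ ℂ a b :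
      Matrix m m ℂ →ₗ[ℂ] ℂ)).differentiableAt.comp z (h2 z hz)
    exact this
  · intro z hz
    have := h3 z hz
    rw [hmat (fun a b => P a b z), hmat (fun a b => P a b p)] at this
    exact this

end Transport

section PMatrix
open scoped Topology ContDiff ComplexConjugate

variable {n : ℕ}

def Dw : Option (Fin n) → (CV n → ℂ) → CV n → ℂ
  | none, f => f
  | some i, f => wd i f

def Dwb : Option (Fin n) → (CV n → ℂ) → CV n → ℂ
  | none, f => f
  | some i, f => wdb i f

def Pm (φ : CV n → ℝ) (a b : Option (Fin n)) : CV n → ℂ := Dw a (Dwb b (uu φ))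

def mmat (φ : CV n → ℝ) (i : Fin n) : Option (Fin n) → Option (Fin n) → CV n → ℂ
  | none, none => fun _ => 0
  | none, some k => fun _ => kd i k
  | some j, none => Bco φ i j
  | some j, some k => Aco φ i j k

variable {φ : CV n → ℝ} {D : Set (CV n)}

lemma sm_Dw (hD : IsOpen D) {f : CV n → ℂ} (hf : ContDiffOn ℝ ∞ f D) (a : Option (Fin n)) :
    ContDiffOn ℝ ∞ (Dw a f) D := by
  cases a with
  | none => exact hf
  | some i => exact hf.wd' hD i

lemma sm_Dwb (hD : IsOpen D) {f : CV n → ℂ} (hf : ContDiffOn ℝ ∞ f D) (a : Option (Fin n)) :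
    ContDiffOn ℝ ∞ (Dwb a f) D := by
  cases a with
  | none => exact hf
  | some i => exact hf.wdb' hD i

lemma sm_Pm (hD : IsOpen D) (hφ : ContDiffOn ℝ ∞ φ D) (a b : Option (Fin n)) :
    ContDiffOn ℝ ∞ (Pm φ a b) D := sm_Dw hD (sm_Dwb hD (sm_uu hφ) b) a

lemma sm_mmat (hD : IsOpen D) (hφ : ContDiffOn ℝ ∞ φ D)
    (hpos : ∀ z ∈ D, (Matrix.of fun i j => gmat φ i j z).PosDef) (i : Fin n)
    (a b : Option (Fin n)) : ContDiffOn ℝ ∞ (mmat φ i a b) D := by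
  rcases a with _ | j <;> rcases b with _ | k
  · exact contDiffOn_const
  · exact contDiffOn_const
  · exact sm_Bco hD hφ hpos i j
  · exact sm_Aco hD hφ hpos i j k

lemma wdb_mmat (hD : IsOpen D) (hφ : ContDiffOn ℝ ∞ φ D)
    (hpos : ∀ z ∈ D, (Matrix.of fun i j => gmat φ i j z).PosDef)
    (hchsc : ∀ z ∈ D, ∀ i j k l : Fin n, Riem (gmat φ) i j k l z
        = -(gmat φ i j z * gmat φ k l z + gmat φ i l z * gmat φ k j z))
    (z : CV n) (hz : z ∈ D) (l i : Fin n)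
    (a b : Option (Fin n)) : wdb l (mmat φ i a b) z = 0 := by
  rcases a with _ | j <;> rcases b with _ | k
  · exact wdb_const _ _ _
  · exact wdb_const _ _ _
  · exact wdb_Bco hD hφ hpos hchsc hz i j l
  · exact wdb_Aco hD hφ hpos hchsc hz i j k l

lemma wd_Pm (hD : IsOpen D) (hφ : ContDiffOn ℝ ∞ φ D)
    (hpos : ∀ z ∈ D, (Matrix.of fun i j => gmat φ i j z).PosDef)
    (hchsc : ∀ z ∈ D, ∀ i j k l : Fin n, Riem (gmat φ) i j k l z
        = -(gmat φ i j z * gmat φ k l z + gmat φ i l z * gmat φ k j z))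
    (z : CV n) (hz : z ∈ D) (i : Fin n) (a b : Option (Fin n)) :
    wd i (Pm φ a b) z = ∑ c, mmat φ i a c z * Pm φ c b z := by
  have hs : Sys φ D (Dwb b (uu φ)) := by
    cases b with
    | none => exact sys_uu hD hφ
    | some l => exact (sys_uu hD hφ).wdb hD hφ hpos hchsc (sm_uu hφ) l
  rw [Fintype.sum_option]
  cases a with
  | none =>
    simp only [mmat, Pm, Dw]
    rw [sum_kd_mul, zero_mul, zero_add]
  | some j => exact hs z hz i j

lemma conj_uu (z : CV n) : conj (uu φ z) = uu φ z := by
  rw [uu, ← Complex.exp_conj]; simp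

lemma Pm_herm (hD : IsOpen D) (hφ : ContDiffOn ℝ ∞ φ D) {z : CV n} (hz : z ∈ D)
    (a b : Option (Fin n)) : conj (Pm φ b a z) = Pm φ a b z := by
  have hu := sm_uu hφ
  have e : (fun w => conj (uu φ w)) = uu φ := funext fun w => conj_uu w
  have h1 : ∀ k, ∀ z ∈ D, conj (wdb k (uu φ) z) = wd k (uu φ) z := fun k z hz => by
    rw [← wd_conj (hu.dAt hD hz), e]
  have h2 : ∀ k, ∀ z ∈ D, conj (wd k (uu φ) z) = wdb k (uu φ) z := fun k z hz => by
    rw [← wdb_conj (hu.dAt hD hz), e]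
  rcases a with _ | j <;> rcases b with _ | k
  · exact conj_uu z
  · exact h2 k z hz
  · exact h1 j z hz
  · show conj (wd k (wdb j (uu φ)) z) = wd j (wdb k (uu φ)) z
    rw [← wdb_conj ((hu.wdb' hD j).dAt hD hz), wdb_congr_on hD (h1 j) k z hz,
      wd_wdb_comm hD hu hz]

lemma wdb_Pm (hD : IsOpen D) (hφ : ContDiffOn ℝ ∞ φ D)
    (hpos : ∀ z ∈ D, (Matrix.of fun i j => gmat φ i j z).PosDef)
    (hchsc : ∀ z ∈ D, ∀ i j k l : Fin n, Riem (gmat φ) i j k l z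
        = -(gmat φ i j z * gmat φ k l z + gmat φ i l z * gmat φ k j z))
    (z : CV n) (hz : z ∈ D) (i : Fin n) (a b : Option (Fin n)) :
    wdb i (Pm φ a b) z = ∑ c, Pm φ a c z * conj (mmat φ i b c z) := by
  rw [← wdb_congr_on hD (fun z hz => Pm_herm hD hφ hz a b) i z hz,
    wdb_conj ((sm_Pm hD hφ b a).dAt hD hz), wd_Pm hD hφ hpos hchsc z hz, map_sum]
  refine Finset.sum_congr rfl fun c _ => ?_
  rw [map_mul, Pm_herm hD hφ hz a c, mul_comm]

lemma Pm_transport (hD : IsOpen D) (hφ : ContDiffOn ℝ ∞ φ D)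
    (hpos : ∀ z ∈ D, (Matrix.of fun i j => gmat φ i j z).PosDef)
    (hchsc : ∀ z ∈ D, ∀ i j k l : Fin n, Riem (gmat φ) i j k l z
        = -(gmat φ i j z * gmat φ k l z + gmat φ i l z * gmat φ k j z))
    {p : CV n} (hp : p ∈ D) :
    ∃ δ > 0, Metric.ball p δ ⊆ D ∧ ∃ H : CV n → Matrix (Option (Fin n)) (Option (Fin n)) ℂ,
      (∀ a b, ∀ z ∈ Metric.ball p δ, DifferentiableAt ℂ (fun z => H z a b) z) ∧ H p = 1 ∧
      ∀ z ∈ Metric.ball p δ, (Matrix.of fun a b => Pm φ a b z)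
        = H z * (Matrix.of fun a b => Pm φ a b p) * (H z)ᴴ :=
  transport hD hp (sm_Pm hD hφ) (sm_mmat hD hφ hpos) (wdb_mmat hD hφ hpos hchsc)
    (wd_Pm hD hφ hpos hchsc) (wdb_Pm hD hφ hpos hchsc)

lemma Pm_some_none (hD : IsOpen D) (hφ : ContDiffOn ℝ ∞ φ D) {z : CV n} (hz : z ∈ D) (i : Fin n) :
    Pm φ (some i) none z = -(fi φ i z * uu φ z) := wd_uu hD hφ hz i

lemma Pm_none_some (hD : IsOpen D) (hφ : ContDiffOn ℝ ∞ φ D) {z : CV n} (hz : z ∈ D) (i : Fin n) :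
    Pm φ none (some i) z = -(conj (fi φ i z) * uu φ z) := by
  rw [← Pm_herm hD hφ hz, Pm_some_none hD hφ hz, map_neg, map_mul, conj_uu]

lemma Pm_some_some (hD : IsOpen D) (hφ : ContDiffOn ℝ ∞ φ D) {z : CV n} (hz : z ∈ D) (i l : Fin n) :
    Pm φ (some i) (some l) z = (fi φ i z * conj (fi φ l z) - gmat φ i l z) * uu φ z := by
  have h1 : Pm φ (some i) (some l) z = wdb l (wd i (uu φ)) z :=
    wd_wdb_comm hD (sm_uu hφ) hz i l
  rw [h1, wdb_congr_on hD (fun z hz => wd_uu hD hφ hz i) l z hz, wdb_neg,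
    wdb_mul ((sm_fi hD hφ i).dAt hD hz) ((sm_uu hφ).dAt hD hz), wdb_fi hD hφ hz]
  have h2 : wdb l (uu φ) z = -(conj (fi φ l z) * uu φ z) := Pm_none_some hD hφ hz l
  rw [h2]; ring

/-- the signature matrix -/
def Jm (n : ℕ) : Matrix (Option (Fin n)) (Option (Fin n)) ℂ :=
  Matrix.diagonal fun a => match a with | none => 1 | some _ => -1

/-- the initial frame -/
def Qm (s : ℂ) (f : Fin n → ℂ) (C : Matrix (Fin n) (Fin n) ℂ) :
    Matrix (Option (Fin n)) (Option (Fin n)) ℂ := Matrix.of fun a b => match a, b with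
  | none, none => s
  | none, some _ => 0
  | some i, none => -(s * f i)
  | some i, some k => s * C i k

lemma Pm_eq_Q (hD : IsOpen D) (hφ : ContDiffOn ℝ ∞ φ D) {z : CV n} (hz : z ∈ D) (s : ℝ)
    (hs : (s : ℂ) * s = uu φ z) (C : Matrix (Fin n) (Fin n) ℂ)
    (hC : (Matrix.of fun i j => gmat φ i j z) = C * Cᴴ) :
    (Matrix.of fun a b => Pm φ a b z) = Qm s (fun i => fi φ i z) C * Jm n
      * (Qm s (fun i => fi φ i z) C)ᴴ := by
  ext a b
  rw [Jm, Matrix.mul_apply]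
  simp only [Matrix.mul_diagonal, Fintype.sum_option, Matrix.conjTranspose_apply, Matrix.of_apply]
  rcases a with _ | j <;> rcases b with _ | k
  · simp only [Qm, Matrix.of_apply]
    simp [hs]; rfl
  · rw [Pm_none_some hD hφ hz, ← hs]
    simp [Qm]; ring
  · rw [Pm_some_none hD hφ hz, ← hs]
    simp [Qm]; ring
  · rw [Pm_some_some hD hφ hz, ← hs]
    have h := congrFun (congrFun hC j) k
    rw [Matrix.mul_apply] at h
    simp only [Matrix.conjTranspose_apply, Matrix.of_apply] at h
    rw [h]
    simp only [Qm, Matrix.of_apply, star_neg, star_mul', sub_mul, Finset.sum_mul]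
    rw [sub_eq_add_neg, ← Finset.sum_neg_distrib]
    simp only [Complex.star_def, Complex.conj_ofReal]
    congr 1
    · ring
    · exact Finset.sum_congr rfl fun _ _ => by ring

lemma Qm_isUnit {s : ℂ} (hs : s ≠ 0) (f : Fin n → ℂ) {C : Matrix (Fin n) (Fin n) ℂ}
    (hC : IsUnit C) : IsUnit (Qm s f C) := by
  rw [← Matrix.mulVec_injective_iff_isUnit] at hC ⊢
  intro v w h
  have h0 := congrFun h none
  have h1 : ∀ i, _ := fun i => congrFun h (some i)
  simp only [Matrix.mulVec, dotProduct, Qm, Fintype.sum_option, Matrix.of_apply, zero_mul,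
    Finset.sum_const_zero, add_zero] at h0 h1
  have h0' : v none = w none := mul_left_cancel₀ hs h0
  have h2 : (fun i => v (some i)) = fun i => w (some i) := by
    apply hC
    ext i
    have := h1 i
    rw [h0'] at this
    have := add_left_cancel this
    simp only [mul_assoc, ← Finset.mul_sum] at this
    exact mul_left_cancel₀ hs this
  ext a
  rcases a with _ | i
  · exact h0'
  · exact congrFun h2 i

end PMatrix

section Frame
open scoped Topology ContDiff ComplexConjugate

variable {n : ℕ} {φ : CV n → ℝ} {D : Set (CV n)}

section
open scoped Matrix.Norms.L2Operator MatrixOrder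
lemma posDef_factor {m : Type} [Fintype m] [DecidableEq m] {G : Matrix m m ℂ} (hG : G.PosDef) :
    ∃ C : Matrix m m ℂ, IsUnit C ∧ G = C * Cᴴ := by
  obtain ⟨y, hy, h⟩ := CStarAlgebra.isStrictlyPositive_iff_eq_star_mul_self.mp
    hG.isStrictlyPositive
  refine ⟨star y, hy.star, ?_⟩
  rw [h, Matrix.star_eq_conjTranspose, Matrix.conjTranspose_conjTranspose]
end

lemma frame (hD : IsOpen D) (hφ : ContDiffOn ℝ ∞ φ D)
    (hpos : ∀ z ∈ D, (Matrix.of fun i j => gmat φ i j z).PosDef)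
    (hchsc : ∀ z ∈ D, ∀ i j k l : Fin n, Riem (gmat φ) i j k l z
        = -(gmat φ i j z * gmat φ k l z + gmat φ i l z * gmat φ k j z))
    {p : CV n} (hp : p ∈ D) :
    ∃ U : Set (CV n), IsOpen U ∧ p ∈ U ∧ U ⊆ D ∧
      ∃ K : CV n → Matrix (Option (Fin n)) (Option (Fin n)) ℂ,
      ∃ s : ℝ, ∃ f : Fin n → ℂ, ∃ C : Matrix (Fin n) (Fin n) ℂ, 0 < s ∧ IsUnit C ∧
      (∀ a b, ∀ z ∈ U, DifferentiableAt ℂ (fun z => K z a b) z) ∧ K p = Qm s f C ∧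
      (∀ z ∈ U, (Matrix.of fun a b => Pm φ a b z) = K z * Jm n * (K z)ᴴ) ∧
      (∀ z ∈ U, ∀ i a, wd i (fun z => K z none a) z = K z (some i) a) := by
  obtain ⟨δ, hδ, hδD, H, hHd, hHp, hH⟩ := Pm_transport hD hφ hpos hchsc hp
  obtain ⟨C, hC, hGC⟩ := posDef_factor (hpos p hp)
  set s : ℝ := Real.exp (-φ p / 2) with hs
  have hs0 : 0 < s := Real.exp_pos _
  have hss : (s : ℂ) * s = uu φ p := by
    rw [uu, hs, ← Complex.ofReal_mul, ← Real.exp_add]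
    push_cast
    congr 1; ring
  set Q := Qm (s : ℂ) (fun i => fi φ i p) C with hQ
  have hQu : IsUnit Q := Qm_isUnit (by exact_mod_cast hs0.ne') _ hC
  have hPQ := Pm_eq_Q hD hφ hp s hss C hGC
  rw [← hQ] at hPQ
  have hpb : p ∈ Metric.ball p δ := Metric.mem_ball_self hδ
  have hdet : ContinuousAt (fun z => (H z).det) p := by
    simp only [Matrix.det_apply']
    refine tendsto_finsetSum _ fun σ _ => tendsto_const_nhds.mul ?_
    exact tendsto_finsetProd _ fun i _ => (hHd _ _ p hpb).continuousAt
  have hev : ∀ᶠ z in 𝓝 p, (H z).det ≠ 0 := hdet.eventually_ne (by simp [hHp])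
  obtain ⟨V, hV, hVo, hpV⟩ := eventually_nhds_iff.1 hev
  have hUo : IsOpen (V ∩ Metric.ball p δ) := hVo.inter Metric.isOpen_ball
  have hKd : ∀ a b, ∀ z ∈ V ∩ Metric.ball p δ, DifferentiableAt ℂ (fun z => (H z * Q) a b) z := by
    intro a b z hz
    simp only [Matrix.mul_apply]
    exact DifferentiableAt.fun_sum fun c _ => (hHd a c z hz.2).mul_const _
  have hPK : ∀ z ∈ V ∩ Metric.ball p δ, (Matrix.of fun a b => Pm φ a b z)
      = (H z * Q) * Jm n * (H z * Q)ᴴ := by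
    intro z hz
    rw [hH z hz.2, hPQ, Matrix.conjTranspose_mul]
    simp only [Matrix.mul_assoc]
  refine ⟨V ∩ Metric.ball p δ, hUo, ⟨hpV, hpb⟩,
    Set.inter_subset_right.trans hδD, fun z => H z * Q, s, fun i => fi φ i p, C, hs0, hC, hKd,
    ?_, hPK, ?_⟩
  · simp [hHp, hQ]
  · intro z hz i
    have hKu : IsUnit (H z * Q) :=
      ((Matrix.isUnit_iff_isUnit_det _).2 (hV z hz.1).isUnit).mul hQu
    have hJu : IsUnit (Jm n) := by
      rw [Matrix.isUnit_iff_isUnit_det, Jm, Matrix.det_diagonal, isUnit_iff_ne_zero,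
        Finset.prod_ne_zero_iff]
      rintro (_ | a) _ <;> simp
    have hR : IsUnit (Jm n * (H z * Q)ᴴ) := hJu.mul (by
      rw [← Matrix.star_eq_conjTranspose]; exact hKu.star)
    set W : Matrix (Option (Fin n)) (Option (Fin n)) ℂ :=
      Matrix.of fun a c => wd i (fun z => (H z * Q) a c) z with hW
    have key : W * (Jm n * (H z * Q)ᴴ)
        = (Matrix.of fun a c => mmat φ i a c z) * (H z * Q) * (Jm n * (H z * Q)ᴴ) := by
      have h1 : (Matrix.of fun a c => mmat φ i a c z) * (Matrix.of fun a b => Pm φ a b z)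
        = Matrix.of fun a b => wd i (Pm φ a b) z := by
        ext a b
        rw [Matrix.mul_apply]
        exact (wd_Pm hD hφ hpos hchsc z (hδD hz.2) i a b).symm
      rw [Matrix.mul_assoc, ← Matrix.mul_assoc (H z * Q), ← hPK z hz, h1]
      ext a b
      have h2 : ∀ z ∈ V ∩ Metric.ball p δ, Pm φ a b z
          = ∑ c, ((H z * Q) a c * (Jm n) c c) * conj ((H z * Q) b c) := by
        intro z hz
        have := congrFun (congrFun (hPK z hz) a) b
        rw [Matrix.of_apply, Matrix.mul_apply] at this
        rw [this]
        simp [Jm, Matrix.mul_diagonal]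
      have dK : ∀ a c, DifferentiableAt ℝ (fun z => (H z * Q) a c) z :=
        fun a c => (hKd a c z hz).restrictScalars ℝ
      have dKc : ∀ a c, DifferentiableAt ℝ (fun z => conj ((H z * Q) a c)) z :=
        fun a c => Complex.conjCLE.toContinuousLinearMap.differentiableAt.comp z (dK a c)
      rw [Matrix.of_apply, wd_congr_on hUo h2 i z hz,
        wd_sum _ (fun c _ => ((dK a c).mul_const _).fun_mul (dKc b c)), Matrix.mul_apply]
      refine Finset.sum_congr rfl fun c _ => ?_
      rw [wd_mul ((dK a c).mul_const _) (dKc b c), wd_conj (dK b c), wdb_of_holo (hKd b c z hz),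
        wd_mul (dK a c) (differentiableAt_const _), wd_const]
      simp [hW, Jm, mul_assoc, -Matrix.conjTranspose_mul, Matrix.conjTranspose_apply]
    have h3 := hR.mul_right_cancel key
    intro a
    have h4 := congrFun (congrFun h3 none) a
    rw [hW, Matrix.of_apply, Matrix.mul_apply, Fintype.sum_option] at h4
    simp only [Matrix.of_apply, mmat, zero_mul, zero_add] at h4
    rw [h4, sum_kd_mul i (fun k => (H z * Q) (some k) a)]

end Frame

section Final
open scoped Topology ContDiff ComplexConjugate

variable {n : ℕ} {φ : CV n → ℝ} {D : Set (CV n)}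

lemma wdb_comb {a b c : CV n → ℂ} {z : CV n} (ha : DifferentiableAt ℝ a z)
    (hb : DifferentiableAt ℂ b z) (hc : DifferentiableAt ℂ c z) (j : Fin n) :
    wdb j (fun w => -a w - b w - conj (c w)) z = -wdb j a z - conj (wd j c z) := by
  have hb' := hb.restrictScalars ℝ
  have hc' := hc.restrictScalars ℝ
  have hcc : DifferentiableAt ℝ (fun z => conj (c z)) z :=
    Complex.conjCLE.toContinuousLinearMap.differentiableAt.comp z hc'
  rw [wdb_sub (ha.fun_neg.fun_sub hb') hcc, wdb_sub ha.fun_neg hb', wdb_neg, wdb_conj hc',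
    wdb_of_holo hb]
  ring

lemma wd_comb {a c : CV n → ℂ} {z : CV n} (ha : DifferentiableAt ℝ a z)
    (hc : DifferentiableAt ℂ c z) (j : Fin n) :
    wd j (fun w => -a w - conj (c w)) z = -wd j a z := by
  have hc' := hc.restrictScalars ℝ
  have hcc : DifferentiableAt ℝ (fun z => conj (c z)) z :=
    Complex.conjCLE.toContinuousLinearMap.differentiableAt.comp z hc'
  rw [wd_sub ha.fun_neg hcc, wd_neg, wd_conj hc', wdb_of_holo hc]
  simp

/-- local injectivity from an invertible Jacobian -/
lemma inj_near {f : CV n → CV n} {p : CV n} {C : Matrix (Fin n) (Fin n) ℂ} (hC : IsUnit C)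
    (hf : ∀ a, HasStrictFDerivAt (fun z => f z a)
      (∑ k, C k a • (EuclideanSpace.proj k : CV n →L[ℂ] ℂ)) p) :
    ∃ V : Set (CV n), IsOpen V ∧ p ∈ V ∧ Set.InjOn f V := by
  let L : CV n →ₗ[ℂ] CV n := Matrix.toEuclideanLin Cᵀ
  have hL : ∀ v a, L v a = ∑ k, C k a * v k := by
    intro v a
    simp [L, Matrix.toEuclideanLin, Matrix.mulVec, dotProduct]
  have hCT : IsUnit Cᵀ := by
    rw [Matrix.isUnit_iff_isUnit_det, Matrix.det_transpose, ← Matrix.isUnit_iff_isUnit_det]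
    exact hC
  have hinj : Function.Injective L := by
    intro v w h
    have h1 := Matrix.mulVec_injective_iff_isUnit.2 hCT
    have : v.ofLp = w.ofLp := by
      apply h1
      ext a
      have := congrArg (fun x : CV n => x a) h
      simp only [hL] at this
      simpa [Matrix.mulVec, dotProduct] using this
    ext a
    rw [this]
  let e : CV n ≃L[ℂ] CV n := (LinearEquiv.ofInjectiveEndo L hinj).toContinuousLinearEquiv
  have hs : HasStrictFDerivAt f (e : CV n →L[ℂ] CV n) p := by
    rw [hasStrictFDerivAt_euclidean]
    intro a
    refine (hf a).congr_fderiv ?_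
    ext v
    have : e v = L v := rfl
    simp [this, hL]
  exact ⟨(hs.toOpenPartialHomeomorph f).source, (hs.toOpenPartialHomeomorph f).open_source,
    hs.mem_toOpenPartialHomeomorph_source, (hs.toOpenPartialHomeomorph f).injOn⟩

lemma main_local (hD : IsOpen D) (hφ : ContDiffOn ℝ ∞ φ D)
    (hpos : ∀ z ∈ D, (Matrix.of fun i j => gmat φ i j z).PosDef)
    (hchsc : ∀ z ∈ D, ∀ i j k l : Fin n, Riem (gmat φ) i j k l z
        = -(gmat φ i j z * gmat φ k l z + gmat φ i l z * gmat φ k j z))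
    {p : CV n} (hp : p ∈ D) :
    ∃ U : Set (CV n), IsOpen U ∧ p ∈ U ∧ U ⊆ D ∧
        ∃ f : CV n → CV n,
          Set.InjOn f U ∧ DifferentiableOn ℂ f U ∧ (∀ z ∈ U, ‖f z‖ < 1) ∧
          ∀ z ∈ U, ∀ i j : Fin n,
            gmat φ i j z
              = -wd i (wdb j (fun w => (Real.log (1 - ‖f w‖ ^ 2) : ℂ))) z := by
  obtain ⟨U, hU, hpU, hUD, K, s, f0, C, hs, hC, hKd, hKp, hPK, hwK⟩ := frame hD hφ hpos hchsc hp
  have hK0p : K p none none = (s : ℂ) := by rw [hKp]; rfl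
  have hev : ∀ᶠ z in 𝓝 p, K z none none ∈ Complex.slitPlane := by
    refine (hKd none none p hpU).continuousAt.eventually_mem
      (Complex.isOpen_slitPlane.mem_nhds ?_)
    rw [hK0p]
    exact Complex.ofReal_mem_slitPlane.2 hs
  obtain ⟨V, hV, hVo, hpV⟩ := eventually_nhds_iff.1 hev
  let f : CV n → CV n := fun z => WithLp.toLp 2 fun a => K z none (some a) * (K z none none)⁻¹
  have hne : ∀ z ∈ V, K z none none ≠ 0 := fun z hz => Complex.slitPlane_ne_zero (hV z hz)
  -- the potential identity
  have hpot : ∀ z ∈ U, Real.exp (-φ z) = ‖K z none none‖ ^ 2 - ∑ a, ‖K z none (some a)‖ ^ 2 := by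
    intro z hz
    have h := congrFun (congrFun (hPK z hz) none) none
    rw [Jm, Matrix.mul_apply] at h
    simp only [Matrix.mul_diagonal, Fintype.sum_option, Matrix.conjTranspose_apply,
      Matrix.of_apply] at h
    have h0 : Pm φ none none z = ((Real.exp (-φ z) : ℝ) : ℂ) := by
      simp [Pm, Dw, Dwb, uu]
    rw [h0] at h
    apply Complex.ofReal_injective
    rw [h]
    push_cast
    rw [sub_eq_add_neg, ← Finset.sum_neg_distrib]
    congr 1
    · rw [mul_one, Complex.star_def, Complex.mul_conj']
    · refine Finset.sum_congr rfl fun a _ => ?_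
      rw [← Complex.mul_conj', Complex.star_def]; ring
  have hfn : ∀ z ∈ U ∩ V, 1 - ‖f z‖ ^ 2 = Real.exp (-φ z) / ‖K z none none‖ ^ 2 := by
    intro z hz
    have h0 : ‖K z none none‖ ≠ 0 := norm_ne_zero_iff.2 (hne z hz.2)
    rw [EuclideanSpace.norm_sq_eq, hpot z hz.1]
    simp only [f, norm_mul, norm_inv, mul_pow, ← Finset.sum_mul]
    field_simp
  -- strict derivatives
  have hst : ∀ a, HasStrictFDerivAt (fun z => K z none a)
      (∑ k, K p (some k) a • (EuclideanSpace.proj k : CV n →L[ℂ] ℂ)) p := by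
    intro a
    apply hasStrictFDerivAt_of_hasFDerivAt_of_continuousAt
      (f' := fun z => ∑ k, K z (some k) a • (EuclideanSpace.proj k : CV n →L[ℂ] ℂ))
    · filter_upwards [hU.mem_nhds hpU] with z hz
      have h := holo_of_wdb ((hKd none a z hz).restrictScalars ℝ)
        (fun k => wdb_of_holo (hKd none a z hz) k)
      simpa only [hwK z hz] using h
    · exact tendsto_finsetSum _ fun k _ =>
        ((hKd (some k) a p hpU).continuousAt.smul continuousAt_const)
  obtain ⟨W, hW, hpW, hinj⟩ := inj_near (f := f) (p := p) hC (fun a => by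
    have h1 := (hst (some a)).mul ((hasStrictDerivAt_inv (hne p hpV)).comp_hasStrictFDerivAt p (hst none))
    refine h1.congr_fderiv ?_
    ext v
    have hsC : (s : ℂ) ≠ 0 := by exact_mod_cast hs.ne'
    simp [hKp, Qm, Finset.mul_sum]
    refine Finset.sum_congr rfl fun k _ => ?_
    field_simp)
  have hUVo : IsOpen (U ∩ V) := hU.inter hVo
  refine ⟨U ∩ V ∩ W, hUVo.inter hW, ⟨⟨hpU, hpV⟩, hpW⟩, fun z hz => hUD hz.1.1, f,
    hinj.mono Set.inter_subset_right, ?_, ?_, ?_⟩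
  · intro z hz
    apply DifferentiableAt.differentiableWithinAt
    rw [differentiableAt_euclidean]
    intro a
    exact (hKd _ _ z hz.1.1).mul ((hKd _ _ z hz.1.1).inv (hne z hz.1.2))
  · intro z hz
    have h := hfn z hz.1
    have h0 : 0 < ‖K z none none‖ := norm_pos_iff.2 (hne z hz.1.2)
    have : 0 < 1 - ‖f z‖ ^ 2 := by rw [h]; positivity
    nlinarith [norm_nonneg (f z)]
  · intro z hz i j
    have hlog : ∀ w ∈ U ∩ V, ((Real.log (1 - ‖f w‖ ^ 2) : ℝ) : ℂ)
        = -(φ w : ℂ) - Complex.log (K w none none) - conj (Complex.log (K w none none)) := by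
      intro w hw
      have h0 : 0 < ‖K w none none‖ := norm_pos_iff.2 (hne w hw.2)
      rw [hfn w hw, Real.log_div (Real.exp_pos _).ne' (by positivity), Real.log_exp, Real.log_pow,
        sub_sub, Complex.add_conj, Complex.log_re]
      push_cast
      ring
    have dlog : ∀ w ∈ U ∩ V, DifferentiableAt ℂ (fun w => Complex.log (K w none none)) w :=
      fun w hw => (hKd none none w hw.1).clog (hV w hw.2)
    have h1 : ∀ w ∈ U ∩ V, wdb j (fun w => ((Real.log (1 - ‖f w‖ ^ 2) : ℝ) : ℂ)) w
        = -wdb j (fun w => (φ w : ℂ)) w - conj ((K w none none)⁻¹ * K w (some j) none) := by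
      intro w hw
      rw [wdb_congr_on hUVo hlog j w hw,
        wdb_comb ((sm_phi hφ).dAt hD (hUD hw.1)) (dlog w hw) (dlog w hw),
        wd_comp_holo ((hKd none none w hw.1).restrictScalars ℝ)
          (Complex.hasDerivAt_log (hV w hw.2)), hwK w hw.1]
    rw [wd_congr_on hUVo h1 i z hz.1,
      wd_comb (((sm_phi hφ).wdb' hD j).dAt hD (hUD hz.1.1))
        (((hKd none none z hz.1.1).fun_inv (hne z hz.1.2)).fun_mul (hKd _ _ z hz.1.1))]
    simp [gmat]

end Final

/-- A Kähler metric `g_{ij̄} = ∂_i∂_j̄ φ` on the unit ball of `ℂⁿ` with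
constant holomorphic sectional curvature `κ = −2` is locally the pull-back of the
complex hyperbolic metric by an injective holomorphic map into the unit ball. -/
theorem chsc_neg_two_local_model (n : ℕ) (φ : EuclideanSpace ℂ (Fin n) → ℝ)
    (hφ : ContDiffOn ℝ (⊤ : ℕ∞) φ (Metric.ball 0 1))
    (hpos : ∀ z ∈ Metric.ball (0 : EuclideanSpace ℂ (Fin n)) 1,
      (Matrix.of fun i j => gmat φ i j z).PosDef)
    (hchsc : ∀ z ∈ Metric.ball (0 : EuclideanSpace ℂ (Fin n)) 1, ∀ i j k l : Fin n,
      Riem (gmat φ) i j k l z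
        = -(gmat φ i j z * gmat φ k l z + gmat φ i l z * gmat φ k j z)) :
    ∀ p ∈ Metric.ball (0 : EuclideanSpace ℂ (Fin n)) 1,
      ∃ U : Set (EuclideanSpace ℂ (Fin n)), IsOpen U ∧ p ∈ U ∧ U ⊆ Metric.ball 0 1 ∧
        ∃ f : EuclideanSpace ℂ (Fin n) → EuclideanSpace ℂ (Fin n),
          Set.InjOn f U ∧ DifferentiableOn ℂ f U ∧ (∀ z ∈ U, ‖f z‖ < 1) ∧
          ∀ z ∈ U, ∀ i j : Fin n,
            gmat φ i j z
              = -wd i (wdb j (fun w => (Real.log (1 - ‖f w‖ ^ 2) : ℂ))) z := by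
  exact fun p hp => main_local Metric.isOpen_ball hφ hpos hchsc hp
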